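/- Let γ > 1/2. For T > 0 and r > 0 define the compact set N_{T,r} = { (t, w, w\bar w + γ(w² + \bar w²) + t² \bar w) : t ∈ [−T,T], w ∈ \bar{D}_r(0) } ⊆ ℂ³. Then there exist T > 0 and r > 0 such that N_{T,r} is polynomially convex and satisfies 𝒫(N_{T,r}) = 𝒞(N_{T,r}); in particular the manifold parametrized by (t,w) ↦ (t, w, w\bar w + γ(w² + \bar w²) + t² \bar w) is locally polynomially convex at 0. -/

import Mathlib

open Complex Metric ComplexConjugate

noncomputable section

/-- A compact set `K ⊆ ℂⁿ` is polynomially convex: every point outside `K` is separated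
from `K` by a holomorphic polynomial. -/
def IsPolyConvex {n : ℕ} (K : Set (Fin n → ℂ)) : Prop :=
  ∀ w : Fin n → ℂ, w ∉ K → ∃ P : MvPolynomial (Fin n) ℂ,
    ∀ z ∈ K, ‖MvPolynomial.eval z P‖ < ‖MvPolynomial.eval w P‖

/-- `𝒫(K) = 𝒞(K)`: every continuous function on `K ⊆ ℂⁿ` is a uniform limit on `K` of
(restrictions of) holomorphic polynomials. -/
def PolyDenseInC {n : ℕ} (K : Set (Fin n → ℂ)) : Prop :=
  ∀ g : K → ℂ, Continuous g → ∀ ε : ℝ, 0 < ε →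
    ∃ P : MvPolynomial (Fin n) ℂ, ∀ z : K, ‖MvPolynomial.eval (z : Fin n → ℂ) P - g z‖ < ε


theorem sq_eq_of_re_pos {a b : ℂ} (h : a^2 = b^2) (ha : 0 < a.re) (hb : 0 < b.re) : a = b := by
  rcases sq_eq_sq_iff_eq_or_eq_neg.mp h with h | h
  · exact h
  · rw [h] at ha; simp at ha; linarith

/-- If the squares differ by a real number, the right half plane roots are close in direction. -/
theorem re_mul_conj_nonneg {a b : ℂ} (h : (a^2).im = (b^2).im) (ha : 0 < a.re) (hb : 0 ≤ b.re) :
    a.re * b.re ≤ (a * conj b).re := by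
  simp [pow_two] at h ⊢
  have h' : a.re * a.im = b.re * b.im := by linarith
  have : a.re * (a.im * b.im) = b.re * b.im^2 := by
    rw [← mul_assoc, h']; ring
  by_contra hc
  have hc' : a.im * b.im < 0 := by linarith
  have h1 : a.re * (a.im * b.im) < 0 := by nlinarith
  have h2 : 0 ≤ b.re * b.im^2 := by positivity
  linarith

theorem sector_bound {p : ℂ} {κ ε : ℝ} (hκ : 0 ≤ κ) (hκ1 : κ ≤ 1) (hε : 0 < ε)
    (hp : κ * ‖p‖ ≤ p.re) : κ * (‖p‖^2 + ε) ≤ ‖p^2 + ε‖ := by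
  apply abs_le_of_sq_le_sq' _ (norm_nonneg _) |>.2
  have e1 : ‖p^2 + ε‖^2 = (‖p‖^2)^2 + 2*ε*(2*p.re^2 - ‖p‖^2) + ε^2 := by
    rw [← normSq_eq_norm_sq, ← normSq_eq_norm_sq, normSq_apply, normSq_apply]
    simp [pow_two]; ring
  rw [e1]
  have h2 : κ^2 * ‖p‖^2 ≤ p.re^2 := by
    rw [← mul_pow]; exact pow_le_pow_left₀ (by positivity) hp 2
  have h3 : κ^2 ≤ 1 := by nlinarith
  have h4 : 0 ≤ (1 - κ^2) * (‖p‖^2 - ε)^2 := mul_nonneg (by linarith) (sq_nonneg _)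
  nlinarith [mul_le_mul_of_nonneg_left h2 hε.le]

theorem re_cpow_pos {q : ℂ} (hq : q ∈ slitPlane) : 0 < (q^(-(1/2 : ℂ))).re := by
  have hne := slitPlane_ne_zero hq
  rw [cpow_def_of_ne_zero hne, exp_re]
  apply mul_pos (Real.exp_pos _)
  have him : (log q * -(1/2 : ℂ)).im = -(q.arg / 2) := by
    simp [mul_im, log_im]; ring
  rw [him]
  have h1 := neg_pi_lt_arg q
  have h2 := arg_le_pi q
  have h3 := (mem_slitPlane_iff_arg.mp hq).1
  have h4 : q.arg < Real.pi := lt_of_le_of_ne h2 h3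
  apply Real.cos_pos_of_mem_Ioo
  constructor <;> linarith

theorem cpow_sq_inv (q : ℂ) : (q^(-(1/2 : ℂ)))^2 = q⁻¹ := by
  rw [← cpow_nat_mul]
  norm_num
  rw [cpow_neg_one]


theorem cm_norm_pow_le {X : Type*} [TopologicalSpace X] [CompactSpace X] (u : C(X,ℂ)) (r : ℝ)
    (hr : 0 ≤ r) (hn : ‖u‖ ≤ r) (k : ℕ) : ‖u ^ k‖ ≤ r ^ k := by
  rw [ContinuousMap.norm_le _ (by positivity)]
  intro x
  rw [ContinuousMap.pow_apply, norm_pow]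
  gcongr
  exact (u.norm_coe_le_norm x).trans hn

theorem exists_coeffs : ∃ c : ℕ → ℂ, Summable (fun k => ‖c k‖ * (1/2 : ℝ)^k) ∧
    ∀ y : ℂ, ‖y‖ ≤ 1/2 → HasSum (fun k => c k * y^k) ((1 + y)^(-(1/2 : ℂ))) := by
  have hF := Complex.one_add_cpow_hasFPowerSeriesOnBall_zero (a := -(1/2 : ℂ))
  generalize binomialSeries ℂ (-(1/2 : ℂ)) = p at hF
  refine ⟨p.coeff, ?_, fun y hy => ?_⟩
  · have := p.summable_norm_mul_pow (r := 1/2) (lt_of_lt_of_le (by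
        exact_mod_cast (by
          rw [← NNReal.coe_lt_coe]; norm_num : (1/2 : NNReal) < 1)) hF.r_le)
    simpa [FormalMultilinearSeries.norm_apply_eq_norm_coef] using this
  · have h2 := hF.hasSum (y := y) (by
      rw [← ENNReal.ofReal_one, Metric.eball_ofReal]
      rw [mem_ball_zero_iff]; linarith)
    simpa [FormalMultilinearSeries.apply_eq_pow_smul_coeff, mul_comm] using h2

theorem invsqrt_mem {X : Type*} [TopologicalSpace X] [CompactSpace X]
    (A : Subalgebra ℂ C(X, ℂ)) (hA : IsClosed (A : Set C(X,ℂ)))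
    (u v : C(X,ℂ)) (hu : u ∈ A) (hn : ‖u‖ ≤ 1/2) (hv : ∀ x, (v x)^2 * (1 + u x) = 1)
    (hre : ∀ x, 0 < (v x).re) : v ∈ A := by
  obtain ⟨c, hc, hF⟩ := exists_coeffs
  have hs : Summable fun k => c k • u ^ k := by
    refine Summable.of_norm_bounded hc fun k => ?_
    rw [norm_smul]
    exact mul_le_mul_of_nonneg_left (cm_norm_pow_le u _ (by norm_num) hn k) (norm_nonneg _)
  have hmem : ∑' k, c k • u ^ k ∈ A := by
    refine hA.mem_of_tendsto hs.hasSum.tendsto_sum_nat (Filter.Eventually.of_forall fun n => ?_)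
    exact A.sum_mem fun k _ => A.smul_mem (A.pow_mem hu k) _
  have hS := hs.hasSum
  generalize ∑' k, c k • u ^ k = S at hmem hS
  suffices hvS : v = S by
    rw [hvS]; exact hmem
  ext x
  have h1 : HasSum (fun k => (c k • u ^ k) x) (S x) :=
    ContinuousMap.hasSum_apply hS x
  have hux : ‖u x‖ ≤ 1/2 := (u.norm_coe_le_norm x).trans hn
  have h3 : S x = (1 + u x)^(-(1/2 : ℂ)) := by
    refine h1.unique ?_
    simpa only [ContinuousMap.smul_apply, ContinuousMap.pow_apply, smul_eq_mul] using hF _ hux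
  rw [h3]
  have hre1 : 0 < (1 + u x).re := by
    have := (abs_re_le_norm (u x)).trans hux
    simp; linarith [neg_abs_le (u x).re]
  apply sq_eq_of_re_pos _ (hre x)
  · exact re_cpow_pos (Or.inl hre1)
  · rw [cpow_sq_inv]
    exact eq_inv_of_mul_eq_one_left (hv x)

theorem slit_of_sector {p : ℂ} {κ t : ℝ} (hκ : 0 < κ) (ht : 0 < t) (hp : κ * ‖p‖ ≤ p.re) :
    p^2 + t ∈ slitPlane := by
  rw [mem_slitPlane_iff]
  by_cases h0 : p.re = 0
  · left
    have : ‖p‖ = 0 := by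
      rw [h0] at hp
      have := norm_nonneg p
      nlinarith
    rw [norm_eq_zero] at this
    simp [this, ht]
  · by_cases hi : p.im = 0
    · left
      simp [pow_two, hi]
      nlinarith [mul_self_nonneg p.re]
    · right
      simp [pow_two]
      intro h
      have : p.re * p.im = 0 := by linarith
      simp [h0, hi] at this

/-- The function `(p² + t)^(-1/2)`. -/
noncomputable def hfun {X : Type*} [TopologicalSpace X] (p : C(X, ℂ)) (κ : ℝ) (hκ : 0 < κ)
    (hp : ∀ x, κ * ‖p x‖ ≤ (p x).re) (t : ℝ) (ht : 0 < t) : C(X, ℂ) where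
  toFun x := (p x ^ 2 + t)^(-(1/2 : ℂ))
  continuous_toFun := by
    refine Continuous.cpow (by fun_prop) (by fun_prop) fun x => ?_
    exact slit_of_sector hκ ht (hp x)

/-- Pointwise root: `a² = p² + t`, `Re a > 0`, and `a` is the inverse of `(p²+t)^(-1/2)`. -/
theorem exists_root {p : ℂ} {κ t : ℝ} (hκ : 0 < κ) (ht : 0 < t) (hp : κ * ‖p‖ ≤ p.re) :
    ∃ a : ℂ, a ≠ 0 ∧ 0 < a.re ∧ a^2 = p^2 + t ∧ (p^2 + t)^(-(1/2 : ℂ)) = a⁻¹ := by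
  have hs := slit_of_sector hκ ht hp
  have hr := re_cpow_pos hs
  have h2 := cpow_sq_inv (p^2 + t)
  generalize (p^2+t : ℂ)^(-(1/2 : ℂ)) = b at hr h2
  have hb : b ≠ 0 := by rintro rfl; simp at hr
  refine ⟨b⁻¹, inv_ne_zero hb, ?_, ?_, (inv_inv b).symm⟩
  · rw [inv_re]
    exact div_pos hr (normSq_pos.mpr hb)
  · rw [inv_pow, h2, inv_inv]

theorem hfun_step {X : Type*} [TopologicalSpace X] [CompactSpace X]
    (A : Subalgebra ℂ C(X, ℂ)) (hA : IsClosed (A : Set C(X,ℂ)))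
    (p : C(X,ℂ)) (κ : ℝ) (hκ : 0 < κ) (hκ1 : κ ≤ 1)
    (hp : ∀ x, κ * ‖p x‖ ≤ (p x).re) (t t' : ℝ) (ht : 0 < t) (ht' : 0 < t')
    (hd : |t' - t| ≤ κ * t / 2) (h : hfun p κ hκ hp t ht ∈ A) : hfun p κ hκ hp t' ht' ∈ A := by
  have hne : ∀ x, hfun p κ hκ hp t ht x ≠ 0 := by
    intro x
    obtain ⟨a, ha0, ha, ha2, hae⟩ := exists_root hκ ht (hp x)
    change (p x ^ 2 + t : ℂ)^(-(1/2 : ℂ)) ≠ 0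
    rw [hae]; exact inv_ne_zero ha0
  let v : C(X,ℂ) := ⟨fun x => hfun p κ hκ hp t' ht' x * (hfun p κ hκ hp t ht x)⁻¹,
    (map_continuous _).mul ((map_continuous _).inv₀ hne)⟩
  let u : C(X,ℂ) := ((t' - t : ℝ) : ℂ) • (hfun p κ hκ hp t ht)^2
  have hu : u ∈ A := A.smul_mem (A.pow_mem h 2) _
  have hv : v ∈ A := by
    refine invsqrt_mem A hA u v hu ?_ ?_ ?_
    · rw [ContinuousMap.norm_le _ (by norm_num)]
      intro x
      obtain ⟨a, ha0, ha, ha2, hae⟩ := exists_root hκ ht (hp x)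
      have hb := sector_bound hκ.le hκ1 ht (hp x)
      change ‖((t' - t : ℝ) : ℂ) • ((p x ^ 2 + t : ℂ)^(-(1/2 : ℂ)))^2‖ ≤ _
      rw [hae, norm_smul, inv_pow, ha2, norm_inv, norm_real, Real.norm_eq_abs]
      have h1 : κ * t ≤ ‖p x ^ 2 + t‖ := by
        refine le_trans ?_ hb
        have : 0 ≤ κ * ‖p x‖^2 := by positivity
        linarith
      have h2 : 0 < κ * t := by positivity
      rw [← div_eq_mul_inv, div_le_iff₀ (by linarith)]
      linarith
    · intro x
      obtain ⟨a, ha0, ha, ha2, hae⟩ := exists_root hκ ht (hp x)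
      obtain ⟨b, hb0, hb, hb2, hbe⟩ := exists_root hκ ht' (hp x)
      change ((p x ^ 2 + t' : ℂ)^(-(1/2 : ℂ)) * ((p x ^ 2 + t : ℂ)^(-(1/2 : ℂ)))⁻¹)^2 *
        (1 + ((t' - t : ℝ) : ℂ) • ((p x ^ 2 + t : ℂ)^(-(1/2 : ℂ)))^2) = 1
      rw [hae, hbe]
      have : ((t' - t : ℝ) : ℂ) = b^2 - a^2 := by rw [hb2, ha2]; push_cast; ring
      rw [this, smul_eq_mul]
      field_simp
      ring
    · intro x
      obtain ⟨a, ha0, ha, ha2, hae⟩ := exists_root hκ ht (hp x)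
      obtain ⟨b, hb0, hb, hb2, hbe⟩ := exists_root hκ ht' (hp x)
      change 0 < ((p x ^ 2 + t' : ℂ)^(-(1/2 : ℂ)) * ((p x ^ 2 + t : ℂ)^(-(1/2 : ℂ)))⁻¹).re
      rw [hae, hbe, inv_inv]
      have h1 := re_mul_conj_nonneg (a := a) (b := b) (by rw [ha2, hb2]; simp) ha hb.le
      have h2 : b⁻¹ * a = (((normSq b)⁻¹ : ℝ) : ℂ) * (a * conj b) := by
        rw [inv_def]; ring
      rw [h2, re_ofReal_mul]
      have := mul_pos ha hb
      exact mul_pos (inv_pos.mpr (normSq_pos.mpr hb0)) (by linarith)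
  have : hfun p κ hκ hp t' ht' = v * hfun p κ hκ hp t ht := by
    ext x
    change _ = (hfun p κ hκ hp t' ht' x * (hfun p κ hκ hp t ht x)⁻¹) * hfun p κ hκ hp t ht x
    rw [inv_mul_cancel_right₀ (hne x)]
  rw [this]
  exact A.mul_mem hv h

theorem hfun_base {X : Type*} [TopologicalSpace X] [CompactSpace X]
    (A : Subalgebra ℂ C(X, ℂ)) (hA : IsClosed (A : Set C(X,ℂ)))
    (p : C(X,ℂ)) (hq : p^2 ∈ A) (κ : ℝ) (hκ : 0 < κ)
    (hp : ∀ x, κ * ‖p x‖ ≤ (p x).re) (t : ℝ) (ht : 0 < t)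
    (hd : 2 * ‖p^2‖ ≤ t) : hfun p κ hκ hp t ht ∈ A := by
  have hst : 0 < √t := Real.sqrt_pos.mpr ht
  have hst' : ((√t : ℝ) : ℂ) ≠ 0 := by exact_mod_cast hst.ne'
  have hsq : ((√t : ℝ) : ℂ)^2 = t := by exact_mod_cast Real.sq_sqrt ht.le
  let v : C(X,ℂ) := ((√t : ℝ) : ℂ) • hfun p κ hκ hp t ht
  let u : C(X,ℂ) := ((t⁻¹ : ℝ) : ℂ) • p^2
  have hu : u ∈ A := A.smul_mem hq _
  have hv : v ∈ A := by
    refine invsqrt_mem A hA u v hu ?_ ?_ ?_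
    · change ‖((t⁻¹ : ℝ) : ℂ) • p^2‖ ≤ _
      rw [norm_smul, norm_real, Real.norm_eq_abs, abs_of_pos (inv_pos.mpr ht), inv_mul_le_iff₀ ht]
      linarith
    · intro x
      obtain ⟨a, ha0, ha, ha2, hae⟩ := exists_root hκ ht (hp x)
      change (((√t : ℝ) : ℂ) • (p x ^ 2 + t : ℂ)^(-(1/2 : ℂ)))^2 *
        (1 + ((t⁻¹ : ℝ) : ℂ) • (p x)^2) = 1
      have h2 : (p x)^2 = a^2 - ((√t : ℝ) : ℂ)^2 := by rw [hsq, ha2]; ring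
      rw [hae, h2, ofReal_inv, ← hsq, smul_eq_mul, smul_eq_mul]
      field_simp
      ring
    · intro x
      change 0 < (((√t : ℝ) : ℂ) * (p x ^ 2 + t : ℂ)^(-(1/2 : ℂ))).re
      rw [re_ofReal_mul]
      exact mul_pos hst (re_cpow_pos (slit_of_sector hκ ht (hp x)))
  have : hfun p κ hκ hp t ht = ((√t : ℝ) : ℂ)⁻¹ • v := by
    change _ = ((√t : ℝ) : ℂ)⁻¹ • (((√t : ℝ) : ℂ) • hfun p κ hκ hp t ht)
    rw [inv_smul_smul₀ hst']
  rw [this]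
  exact A.smul_mem hv _

theorem hfun_small {X : Type*} [TopologicalSpace X] [CompactSpace X]
    (A : Subalgebra ℂ C(X, ℂ)) (hA : IsClosed (A : Set C(X,ℂ)))
    (p : C(X,ℂ)) (hq : p^2 ∈ A) (κ : ℝ) (hκ : 0 < κ) (hκ1 : κ ≤ 1)
    (hp : ∀ x, κ * ‖p x‖ ≤ (p x).re) (δ : ℝ) (hδ : 0 < δ) :
    ∃ t, ∃ ht : 0 < t, t < δ ∧ hfun p κ hκ hp t ht ∈ A := by
  set T := 2 * ‖p^2‖ + 1 with hT
  have hT0 : 0 < T := by positivity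
  have hc : 0 < 1 - κ/2 := by linarith
  have key : ∀ n : ℕ, ∃ ht : 0 < T * (1 - κ/2)^n, hfun p κ hκ hp (T * (1-κ/2)^n) ht ∈ A := by
    intro n
    have hpos : ∀ n : ℕ, 0 < T * (1 - κ/2)^n := fun n => by positivity
    refine ⟨hpos n, ?_⟩
    induction n with
    | zero => exact hfun_base A hA p hq κ hκ hp _ _ (by simp [hT])
    | succ n ih =>
      refine hfun_step A hA p κ hκ hκ1 hp _ _ (hpos n) _ ?_ ih
      have : T * (1-κ/2)^(n+1) - T * (1-κ/2)^n = -(κ * (T * (1-κ/2)^n) / 2) := by ring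
      rw [this, abs_neg, abs_of_pos]
      have := hpos n
      positivity
  obtain ⟨n, hn⟩ := exists_pow_lt_of_lt_one (div_pos hδ hT0) (by linarith : 1 - κ/2 < 1)
  obtain ⟨ht, h⟩ := key n
  refine ⟨_, ht, ?_, h⟩
  rw [lt_div_iff₀ hT0] at hn
  linarith

theorem err_bound {s p : ℂ} {κ t C : ℝ} (hκ : 0 < κ) (hκ1 : κ ≤ 1) (ht : 0 < t) (hC : 0 ≤ C)
    (hp : κ * ‖p‖ ≤ p.re) (hs : ‖s‖^2 ≤ C * ‖p‖) :
    ‖s * p * (p^2 + t : ℂ)^(-(1/2 : ℂ)) - s‖^2 ≤ C * √t / κ^2 := by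
  obtain ⟨a, ha0, ha, ha2, hae⟩ := exists_root hκ ht hp
  have hb := sector_bound hκ.le hκ1 ht hp
  rw [hae]
  have hre : 0 ≤ p.re := le_trans (by positivity) hp
  have h1 := re_mul_conj_nonneg (a := a) (b := p) (by rw [ha2]; simp) ha hre
  have h2 : ‖a‖ ≤ ‖a + p‖ := by
    apply abs_le_of_sq_le_sq' _ (norm_nonneg _) |>.2
    rw [← normSq_eq_norm_sq, ← normSq_eq_norm_sq, normSq_add]
    have := normSq_nonneg p
    have := mul_nonneg ha.le hre
    linarith
  have hap : 0 < ‖a + p‖ := lt_of_lt_of_le (norm_pos_iff.mpr ha0) h2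
  have hap' : a + p ≠ 0 := norm_pos_iff.mp hap
  have e : s * p * a⁻¹ - s = -(s * t) / (a * (a + p)) := by
    have : (t : ℂ) = a^2 - p^2 := by rw [ha2]; ring
    rw [this]
    field_simp
    ring
  have h3 : κ * (‖p‖^2 + t) ≤ ‖a * (a + p)‖ := by
    calc _ ≤ ‖a‖ * ‖a‖ := by rw [← norm_mul, ← pow_two, ha2]; exact hb
      _ ≤ ‖a‖ * ‖a + p‖ := by gcongr
      _ = _ := (norm_mul _ _).symm
  have hst := Real.sqrt_pos.mpr ht
  have hsq := Real.sq_sqrt ht.le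
  rw [e, norm_div, norm_neg, norm_mul, norm_real, Real.norm_eq_abs, abs_of_pos ht, div_pow, mul_pow]
  calc _ ≤ (C * ‖p‖) * t^2 / (κ * (‖p‖^2 + t))^2 := by gcongr
    _ ≤ _ := by
      rw [mul_pow, div_le_div_iff₀ (by positivity) (by positivity)]
      have h4 : ‖p‖ * t^2 ≤ √t * (‖p‖^2 + t)^2 := by
        set r := √t
        rw [← hsq]
        have hp0 := norm_nonneg p
        set P := ‖p‖
        have : 0 ≤ r * ((P^2 + r^2)^2 - P * r^3) := by
          apply mul_nonneg hst.le
          have : P * r ≤ P^2 + r^2 := by nlinarith [sq_nonneg (P - r)]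
          have h5 : (P * r) * r^2 ≤ (P^2 + r^2) * (P^2 + r^2) := by
            apply mul_le_mul this _ (by positivity) (by positivity)
            nlinarith
          nlinarith
        nlinarith
      have : 0 ≤ C * κ^2 := by positivity
      nlinarith [mul_le_mul_of_nonneg_left h4 this]

theorem s_mem {X : Type*} [TopologicalSpace X] [CompactSpace X]
    (A : Subalgebra ℂ C(X, ℂ)) (hA : IsClosed (A : Set C(X,ℂ)))
    (z s : C(X,ℂ)) (hz : z ∈ A) (hs : s^2 ∈ A) (κ C : ℝ) (hκ : 0 < κ) (hκ1 : κ ≤ 1)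
    (hC : 0 < C) (hp : ∀ x, κ * ‖z x * s x‖ ≤ (z x * s x).re)
    (hsb : ∀ x, ‖s x‖^2 ≤ C * ‖z x * s x‖) : s ∈ A := by
  have hq : (z * s)^2 ∈ A := by
    rw [mul_pow]; exact A.mul_mem (A.pow_mem hz 2) hs
  have hA' : closure (A : Set C(X,ℂ)) = A := hA.closure_eq
  rw [← SetLike.mem_coe, ← hA', Metric.mem_closure_iff]
  intro δ hδ
  have hp' : ∀ x, κ * ‖(z * s) x‖ ≤ ((z * s) x).re := hp
  obtain ⟨t, ht, htδ, hm⟩ := hfun_small A hA (z * s) hq κ hκ hκ1 hp' ((κ^2 * (δ/2)^2 / C)^2)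
    (by positivity)
  refine ⟨z * s^2 * hfun (z * s) κ hκ hp' t ht, A.mul_mem (A.mul_mem hz hs) hm, ?_⟩
  rw [dist_comm, dist_eq_norm]
  refine lt_of_le_of_lt ?_ (by linarith : δ/2 < δ)
  rw [ContinuousMap.norm_le _ (by positivity)]
  intro x
  have := err_bound hκ hκ1 ht hC.le (hp x) (hsb x)
  have e : (z * s^2 * hfun (z * s) κ hκ hp' t ht - s) x =
    s x * (z x * s x) * ((z x * s x)^2 + t : ℂ)^(-(1/2 : ℂ)) - s x := by
    change z x * (s x)^2 * ((z x * s x)^2 + t : ℂ)^(-(1/2 : ℂ)) - s x = _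
    ring
  rw [e]
  apply abs_le_of_sq_le_sq' _ (by positivity) |>.2
  refine this.trans ?_
  have h5 : √t ≤ κ^2 * (δ/2)^2 / C := Real.sqrt_le_iff.mpr ⟨by positivity, htδ.le⟩
  rw [le_div_iff₀ hC] at h5
  rw [div_le_iff₀ (by positivity)]
  linarith

theorem polyConvex_of_dense {n : ℕ} (K : Set (Fin n → ℂ)) (hK : IsCompact K)
    (h : PolyDenseInC K) : IsPolyConvex K := by
  intro w hw
  have : CompactSpace K := isCompact_iff_compactSpace.mp hK
  have hco : ∀ i, Continuous fun z : K => z.1 i :=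
    fun i => (continuous_apply i).comp continuous_subtype_val
  let G : (Fin n → ℂ) → ℂ := fun z => ∑ i, (z i - w i) * conj (z i - w i)
  have hG0 : ∀ z : K, G z ≠ 0 := by
    intro z hz
    have e : G z = ((∑ i, ‖z.1 i - w i‖^2 : ℝ) : ℂ) := by
      simp only [G, mul_conj, normSq_eq_norm_sq]
      push_cast; rfl
    rw [e] at hz
    have hz' : ∑ i, ‖z.1 i - w i‖^2 = 0 := by exact_mod_cast hz
    rw [Finset.sum_eq_zero_iff_of_nonneg (fun i _ => by positivity)] at hz'
    apply hw
    have : z.1 = w := by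
      ext i
      have := hz' i (Finset.mem_univ i)
      simpa [sub_eq_zero] using this
    rw [← this]; exact z.2
  have hGc : Continuous fun z : K => G z := by
    exact continuous_finsetSum _ fun i _ => ((hco i).sub continuous_const).mul
      (continuous_conj.comp ((hco i).sub continuous_const))
  obtain ⟨M, hM0, hM⟩ : ∃ M : ℝ, 0 < M ∧ ∀ z : K, ∑ i, ‖z.1 i - w i‖ ≤ M := by
    have hc : Continuous fun z : K => ∑ i, ‖z.1 i - w i‖ :=
      continuous_finsetSum _ fun i _ => ((hco i).sub continuous_const).norm
    obtain ⟨M, hM⟩ := (isCompact_range hc).bddAbove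
    exact ⟨max M 1, by positivity, fun z => (hM ⟨z, rfl⟩).trans (le_max_left _ _)⟩
  have hP : ∀ i, ∃ P : MvPolynomial (Fin n) ℂ, ∀ z : K,
      ‖MvPolynomial.eval (z : Fin n → ℂ) P - conj (z.1 i - w i) / G z‖ < 1 / (2 * M) := by
    intro i
    refine h _ ?_ _ (by positivity)
    exact Continuous.div (continuous_conj.comp ((hco i).sub continuous_const)) hGc hG0
  choose P hP using hP
  refine ⟨1 - ∑ i, (MvPolynomial.X i - MvPolynomial.C (w i)) * P i, fun z hz => ?_⟩
  have h1 : MvPolynomial.eval w (1 - ∑ i, (MvPolynomial.X i - MvPolynomial.C (w i)) * P i) = 1 := by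
    simp
  rw [h1, norm_one]
  have h2 : MvPolynomial.eval z (1 - ∑ i, (MvPolynomial.X i - MvPolynomial.C (w i)) * P i) =
      - ∑ i, (z i - w i) * (MvPolynomial.eval z (P i) - conj (z i - w i) / G z) := by
    have h3 : ∑ i, (z i - w i) * (conj (z i - w i) / G z) = 1 := by
      simp_rw [← mul_div_assoc]
      rw [← Finset.sum_div]
      exact div_self (hG0 ⟨z, hz⟩)
    simp only [mul_sub, Finset.sum_sub_distrib] at h3 ⊢
    rw [h3]
    simp
  rw [h2, norm_neg]
  calc _ ≤ ∑ i, ‖(z i - w i) * (MvPolynomial.eval z (P i) - conj (z i - w i) / G z)‖ :=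
        norm_sum_le _ _
    _ ≤ ∑ i, ‖z i - w i‖ * (1 / (2 * M)) := by
        refine Finset.sum_le_sum fun i _ => ?_
        rw [norm_mul]
        exact mul_le_mul_of_nonneg_left (hP i ⟨z, hz⟩).le (norm_nonneg _)
    _ = (∑ i, ‖z i - w i‖) * (1 / (2 * M)) := by rw [Finset.sum_mul]
    _ ≤ M * (1 / (2 * M)) := by
        refine mul_le_mul_of_nonneg_right (hM ⟨z, hz⟩) (by positivity)
    _ < 1 := by field_simp; norm_num

theorem sector_est {β : ℝ} (h0 : 0 < β) (h1 : β < 1) (u : ℂ) :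
    ((1 - β) / (1 + β)) * ‖u * (conj u + β * u)‖ ≤ (u * (conj u + β * u)).re ∧
    ‖conj u + β * u‖^2 ≤ (4 / (1 - β)) * ‖u * (conj u + β * u)‖ := by
  have hre : (1 - β) * ‖u‖^2 ≤ (u * (conj u + β * u)).re := by
    rw [← normSq_eq_norm_sq, normSq_apply]
    simp
    nlinarith [mul_self_nonneg u.re]
  have hs : ‖conj u + β * u‖ ≤ (1 + β) * ‖u‖ := by
    refine (norm_add_le _ _).trans ?_
    rw [norm_mul, norm_real, Real.norm_eq_abs, abs_of_pos h0, norm_conj]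
    linarith
  have hu := norm_nonneg u
  have hb : 0 < 1 - β := by linarith
  constructor
  · rw [div_mul_eq_mul_div, div_le_iff₀ (by linarith), norm_mul]
    calc _ ≤ (1 - β) * (‖u‖ * ((1 + β) * ‖u‖)) := by gcongr
      _ = ((1 - β) * ‖u‖^2) * (1 + β) := by ring
      _ ≤ _ := by gcongr
  · have h2 : (1 - β) * ‖u‖^2 ≤ ‖u * (conj u + β * u)‖ := hre.trans (re_le_norm _)
    rw [div_mul_eq_mul_div, le_div_iff₀ hb]
    calc _ ≤ ((1 + β) * ‖u‖)^2 * (1 - β) := by gcongr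
      _ ≤ (2 * ‖u‖)^2 * (1 - β) := by gcongr; linarith
      _ = 4 * ((1 - β) * ‖u‖^2) := by ring
      _ ≤ _ := by gcongr

theorem dense_main (γ : ℝ) (hγ : 1/2 < γ) (K : Set (Fin 3 → ℂ)) (hK : IsCompact K)
    (hp : ∀ p ∈ K, conj (p 0) = p 0 ∧ p 2 = p 1 * conj (p 1) +
      (γ:ℂ) * ((p 1)^2 + (conj (p 1))^2) + (p 0)^2 * conj (p 1)) : PolyDenseInC K := by
  have : CompactSpace K := isCompact_iff_compactSpace.mp hK
  let e : Fin 3 → C(K, ℂ) := fun i => ⟨fun x => x.1 i,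
    (continuous_apply i).comp continuous_subtype_val⟩
  let A0 : Subalgebra ℂ C(K, ℂ) := (MvPolynomial.aeval (R := ℂ) e).range
  let A : Subalgebra ℂ C(K, ℂ) := A0.topologicalClosure
  have hA : IsClosed (A : Set C(K, ℂ)) := A0.isClosed_topologicalClosure
  have he : ∀ i, e i ∈ A := fun i =>
    A0.le_topologicalClosure ⟨MvPolynomial.X i, by simp⟩
  have hev : ∀ (P : MvPolynomial (Fin 3) ℂ) (x : K),
      (MvPolynomial.aeval (R := ℂ) e P) x = MvPolynomial.eval x.1 P := by
    intro P x
    induction P using MvPolynomial.induction_on with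
    | C a => simp
    | add p q hp hq => simp [hp, hq]
    | mul_X p i hp => simp [hp, e]
  have hγ0 : (γ : ℂ) ≠ 0 := by
    have : γ ≠ 0 := by linarith
    exact_mod_cast this
  have hγ1 : (2 * γ + 1 : ℂ) ≠ 0 := by
    have : (2 * γ + 1) ≠ 0 := by linarith
    exact_mod_cast this
  set k : ℝ := 1 / (2 * γ + 1) with hk
  set β : ℝ := 1 / (2 * γ) with hβ
  have hβ0 : 0 < β := by positivity
  have hβ1 : β < 1 := by rw [hβ, div_lt_one (by linarith)]; linarith
  let u : C(K, ℂ) := e 1 + (k : ℂ) • (e 0)^2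
  have hu : u ∈ A := A.add_mem (he 1) (A.smul_mem (A.pow_mem (he 0) 2) _)
  let s : C(K, ℂ) := star u + (β : ℂ) • u
  have hs2 : s^2 ∈ A := by
    have : s^2 = (γ : ℂ)⁻¹ • (e 2 + (e 0)^2 * u + (1/(4 * γ) - γ : ℂ) • u^2) := by
      ext x
      obtain ⟨h0, h2⟩ := hp x.1 x.2
      change (conj (x.1 1 + (k:ℂ) * (x.1 0)^2) + (β : ℂ) * (x.1 1 + (k:ℂ) * (x.1 0)^2))^2 =
        (γ : ℂ)⁻¹ * (x.1 2 + (x.1 0)^2 * (x.1 1 + (k:ℂ) * (x.1 0)^2) + (1/(4 * γ) - γ : ℂ) *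
          (x.1 1 + (k:ℂ) * (x.1 0)^2)^2)
      rw [h2, map_add, map_mul, map_pow, h0, conj_ofReal, hk, hβ]
      push_cast
      generalize conj (x.1 1) = wb
      field_simp
      ring
    rw [this]
    exact A.smul_mem (A.add_mem (A.add_mem (he 2) (A.mul_mem (A.pow_mem (he 0) 2) hu))
      (A.smul_mem (A.pow_mem hu 2) _)) _
  have hb : 0 < 1 - β := by linarith
  have hs : s ∈ A := by
    refine s_mem A hA u s hu hs2 ((1 - β) / (1 + β)) (4 / (1 - β)) (by positivity) ?_ (by positivity)
      (fun x => (sector_est hβ0 hβ1 (u x)).1) (fun x => (sector_est hβ0 hβ1 (u x)).2)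
    rw [div_le_one (by linarith)]; linarith
  have hstar0 : star (e 0) = e 0 := by
    ext x
    exact (hp x.1 x.2).1
  have hstar1 : star (e 1) ∈ A := by
    have : star (e 1) = s - (β : ℂ) • u - (k : ℂ) • (e 0)^2 := by
      ext x
      obtain ⟨h0, -⟩ := hp x.1 x.2
      change conj (x.1 1) = (conj (x.1 1 + (k:ℂ) * (x.1 0)^2) + (β : ℂ) * u x) - (β : ℂ) * u x -
        (k:ℂ) * (x.1 0)^2
      rw [map_add, map_mul, map_pow, h0, conj_ofReal]
      ring
    rw [this]
    exact A.sub_mem (A.sub_mem hs (A.smul_mem hu _)) (A.smul_mem (A.pow_mem (he 0) 2) _)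
  let S : StarSubalgebra ℂ C(K, ℂ) := StarAlgebra.adjoin ℂ {e 0, e 1}
  have hSA : S.toSubalgebra ≤ A := by
    rw [StarAlgebra.adjoin_toSubalgebra, Algebra.adjoin_le_iff]
    rintro f (hf | hf)
    · rcases hf with rfl | rfl
      · exact he 0
      · exact he 1
    · rw [Set.mem_star] at hf
      rcases hf with hf | hf
      · rw [← star_star f, hf, hstar0]; exact he 0
      · rw [Set.mem_singleton_iff] at hf
        rw [← star_star f, hf]; exact hstar1
  have hsep : S.toSubalgebra.SeparatesPoints := by
    intro x y hxy
    by_contra hcon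
    push Not at hcon
    have h0 : x.1 0 = y.1 0 := hcon _ ⟨e 0, StarAlgebra.subset_adjoin ℂ _ (by simp), rfl⟩
    have h1 : x.1 1 = y.1 1 := hcon _ ⟨e 1, StarAlgebra.subset_adjoin ℂ _ (by simp), rfl⟩
    apply hxy
    ext i
    fin_cases i
    · exact h0
    · exact h1
    · change x.1 2 = y.1 2
      rw [(hp x.1 x.2).2, (hp y.1 y.2).2, h0, h1]
  have htop := ContinuousMap.starSubalgebra_topologicalClosure_eq_top_of_separatesPoints S hsep
  intro g hg ε hε
  let g' : C(K, ℂ) := ⟨g, hg⟩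
  have hgS : g' ∈ closure (S : Set C(K, ℂ)) := by
    have : g' ∈ S.topologicalClosure := by rw [htop]; trivial
    exact this
  have hgA : g' ∈ A := closure_minimal hSA hA hgS
  have hgA' : g' ∈ closure (A0 : Set C(K, ℂ)) := hgA
  rw [Metric.mem_closure_iff] at hgA'
  obtain ⟨f, ⟨P, rfl⟩, hf⟩ := hgA' ε hε
  refine ⟨P, fun x => ?_⟩
  rw [← hev, ← dist_eq_norm, dist_comm]
  exact (ContinuousMap.dist_apply_le_dist x).trans_lt hf

/-- Let `γ > 1/2`. For `T, r > 0` let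
`N_{T,r} = {(t, w, w w̄ + γ(w² + w̄²) + t² w̄) : t ∈ [−T,T], w ∈ D̄_r(0)} ⊆ ℂ³`. Then there
exist `T > 0` and `r > 0` such that `N_{T,r}` is polynomially convex and `𝒫 = 𝒞` holds on it;
in particular the parametrized manifold is locally polynomially convex at `0`. -/
theorem polyConvex_example_t_sq_wbar (γ : ℝ) (hγ : 1/2 < γ)
    (N : ℝ → ℝ → Set (Fin 3 → ℂ))
    (hN : ∀ T r : ℝ, N T r = { p : Fin 3 → ℂ | ∃ t : ℝ, ∃ w : ℂ, |t| ≤ T ∧ ‖w‖ ≤ r ∧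
      p = ![(t : ℂ), w,
        w * conj w + (γ:ℂ) * (w^2 + (conj w)^2) + (t:ℂ)^2 * conj w] }) :
    ∃ T > (0:ℝ), ∃ r > (0:ℝ), IsPolyConvex (N T r) ∧ PolyDenseInC (N T r) := by
  have hc : IsCompact (N 1 1) := by
    have : N 1 1 = (fun q : ℝ × ℂ => (![(q.1 : ℂ), q.2,
        q.2 * conj q.2 + (γ:ℂ) * (q.2^2 + (conj q.2)^2) + (q.1:ℂ)^2 * conj q.2] : Fin 3 → ℂ)) ''
        (Set.Icc (-1) 1 ×ˢ closedBall 0 1) := by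
      rw [hN]
      ext p
      constructor
      · rintro ⟨t, w, ht, hw, rfl⟩
        exact ⟨(t, w), ⟨abs_le.mp ht, by simpa using hw⟩, rfl⟩
      · rintro ⟨⟨t, w⟩, ⟨ht, hw⟩, rfl⟩
        exact ⟨t, w, abs_le.mpr ht, by simpa using hw, rfl⟩
    rw [this]
    apply (isCompact_Icc.prod (isCompact_closedBall _ _)).image
    apply continuous_pi
    intro i
    fin_cases i
    · change Continuous fun q : ℝ × ℂ => (q.1 : ℂ)
      fun_prop
    · change Continuous fun q : ℝ × ℂ => q.2
      fun_prop
    · change Continuous fun q : ℝ × ℂ =>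
        q.2 * conj q.2 + (γ:ℂ) * (q.2^2 + (conj q.2)^2) + (q.1:ℂ)^2 * conj q.2
      fun_prop
  have hd : PolyDenseInC (N 1 1) := by
    refine dense_main γ hγ _ hc fun p hp => ?_
    rw [hN] at hp
    obtain ⟨t, w, -, -, rfl⟩ := hp
    exact ⟨conj_ofReal t, rfl⟩
  exact ⟨1, one_pos, 1, one_pos, polyConvex_of_dense _ hc hd, hd⟩
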